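/- Let G be a (P5,dart)-free finite simple graph containing an induced 5-cycle C with vertices v1,...,v5, and let the sets S2(i), S3^1(i) be defined with respect to C as in the context. Then for each 1 ≤ i ≤ 5, S2(i) is complete to S3^1(i+1) ∪ S3^1(i−1), i.e., every vertex of S2(i) is adjacent to every vertex of S3^1(i+1) ∪ S3^1(i−1). -/

import Mathlib

open SimpleGraph

/-- `G` contains an induced subgraph isomorphic to `H`. -/
def ContainsInduced {V : Type*} {W : Type*} (G : SimpleGraph V) (H : SimpleGraph W) : Prop :=
  ∃ f : W ↪ V, ∀ a b, H.Adj a b ↔ G.Adj (f a) (f b)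

/-- The path on 5 vertices. -/
def P5 : SimpleGraph (Fin 5) := SimpleGraph.pathGraph 5

/-- The dart: vertices `0,1,2,3,4` and edges `01, 12, 23, 30, 02, 24`. -/
def dart : SimpleGraph (Fin 5) :=
  SimpleGraph.fromRel (fun a b =>
    (a, b) = (0, 1) ∨ (a, b) = (1, 2) ∨ (a, b) = (2, 3) ∨
    (a, b) = (3, 0) ∨ (a, b) = (0, 2) ∨ (a, b) = (2, 4))

/-- `G` is `k`-vertex-critical: `χ(G) = k` and `χ(G - v) < k` for every vertex `v`. -/
def IsVertexCritical {V : Type*} (G : SimpleGraph V) (k : ℕ) : Prop :=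
  G.chromaticNumber = k ∧
  ∀ v : V, (G.induce {u | u ≠ v}).chromaticNumber < k

/-- The cycle on 5 vertices (indices in `Fin 5`, `i` adjacent to `i + 1`). -/
def C5 : SimpleGraph (Fin 5) := SimpleGraph.fromRel (fun a b => b = a + 1)

/-- `S0`: the vertices off the 5-cycle `v` with no neighbour on it. -/
def S0 {V : Type*} (G : SimpleGraph V) (v : Fin 5 → V) : Set V :=
  {u | u ∉ Set.range v ∧ ∀ j, ¬ G.Adj u (v j)}

/-- `S2(i)`: vertices off the 5-cycle `v` whose neighbourhood on it is exactly
`{v (i-1), v (i+1)}`. -/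
def S2 {V : Type*} (G : SimpleGraph V) (v : Fin 5 → V) (i : Fin 5) : Set V :=
  {u | u ∉ Set.range v ∧ ∀ j, G.Adj u (v j) ↔ (j = i - 1 ∨ j = i + 1)}

/-- `S3^1(i)`: vertices off the 5-cycle `v` whose neighbourhood on it is exactly
`{v (i-1), v i, v (i+1)}`. -/
def S31 {V : Type*} (G : SimpleGraph V) (v : Fin 5 → V) (i : Fin 5) : Set V :=
  {u | u ∉ Set.range v ∧ ∀ j, G.Adj u (v j) ↔ (j = i - 1 ∨ j = i ∨ j = i + 1)}

/-- `S3^2(i)`: vertices off the 5-cycle `v` whose neighbourhood on it is exactly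
`{v (i-2), v i, v (i+2)}`. -/
def S32 {V : Type*} (G : SimpleGraph V) (v : Fin 5 → V) (i : Fin 5) : Set V :=
  {u | u ∉ Set.range v ∧ ∀ j, G.Adj u (v j) ↔ (j = i - 2 ∨ j = i ∨ j = i + 2)}

/-- `S4(i)`: vertices off the 5-cycle `v` whose neighbourhood on it is exactly
`{v (i-2), v (i-1), v (i+1), v (i+2)}`. -/
def S4 {V : Type*} (G : SimpleGraph V) (v : Fin 5 → V) (i : Fin 5) : Set V :=
  {u | u ∉ Set.range v ∧
    ∀ j, G.Adj u (v j) ↔ (j = i - 2 ∨ j = i - 1 ∨ j = i + 1 ∨ j = i + 2)}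

/-- `S5`: vertices off the 5-cycle `v` adjacent to all five of its vertices. -/
def S5 {V : Type*} (G : SimpleGraph V) (v : Fin 5 → V) : Set V :=
  {u | u ∉ Set.range v ∧ ∀ j, G.Adj u (v j)}

theorem containsInduced_dart {V : Type*} {G : SimpleGraph V} {a b c d e : V} (hbd_ne : b ≠ d)
    (hab : G.Adj a b) (hbc : G.Adj b c) (hcd : G.Adj c d) (hda : G.Adj d a) (hac : G.Adj a c)
    (hce : G.Adj c e) (hbd : ¬ G.Adj b d) (hae : ¬ G.Adj a e) (hbe : ¬ G.Adj b e)
    (hde : ¬ G.Adj d e) : ContainsInduced G dart := by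
  have hadj : ∀ x y, dart.Adj x y ↔ G.Adj (![a, b, c, d, e] x) (![a, b, c, d, e] y) := by
    intro x y
    fin_cases x <;> fin_cases y <;> simp [dart] <;> grind [G.adj_comm]
  refine ⟨⟨![a, b, c, d, e], fun x y hxy => ?_⟩, hadj⟩
  have hab_ne := hab.ne
  have hbc_ne := hbc.ne
  have hcd_ne := hcd.ne
  have hda_ne := hda.ne
  have hac_ne := hac.ne
  have hce_ne := hce.ne
  fin_cases x <;> fin_cases y <;> simp at hxy ⊢ <;> grind [G.adj_comm]

theorem C5_adj_iff (i j : Fin 5) : C5.Adj i j ↔ j = i + 1 ∨ i = j + 1 := by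
  simp only [C5, SimpleGraph.fromRel_adj]
  revert i j
  decide

theorem S2_complete_S31_neighbours {V : Type} [Fintype V] (G : SimpleGraph V)
    (hP5 : ¬ ContainsInduced G P5) (hdart : ¬ ContainsInduced G dart)
    (v : Fin 5 → V) (hinj : Function.Injective v)
    (hC : ∀ i j, G.Adj (v i) (v j) ↔ C5.Adj i j) :
    ∀ i : Fin 5, ∀ a ∈ S2 G v i, ∀ b ∈ S31 G v (i + 1) ∪ S31 G v (i - 1), G.Adj a b := by
  rintro i a ⟨-, ha⟩ b (⟨-, hb⟩ | ⟨-, hb⟩) <;> by_contra hab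
  · refine hdart (containsInduced_dart (a := b) (b := v i) (c := v (i + 1)) (d := v (i + 2))
      (e := a) (hinj.ne (by grind)) ?_ ?_ ?_ ?_ ?_ ?_ ?_ (fun h => hab h.symm) ?_ ?_) <;>
      simp only [G.adj_comm (v _) a, G.adj_comm (v _) b, ha, hb, hC, C5_adj_iff] <;>
      clear * - <;> revert i <;> decide
  · refine hdart (containsInduced_dart (a := b) (b := v i) (c := v (i - 1)) (d := v (i - 2))
      (e := a) (hinj.ne (by grind)) ?_ ?_ ?_ ?_ ?_ ?_ ?_ (fun h => hab h.symm) ?_ ?_) <;>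
      simp only [G.adj_comm (v _) a, G.adj_comm (v _) b, ha, hb, hC, C5_adj_iff] <;>
      clear * - <;> revert i <;> decide
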